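/- Let f : ℕ → ℂ be a non-identically-zero function that is periodic with period q ≥ 1, and let α = a/b be a rational number with gcd(a,b) = 1, 1 ≤ a < b, and a/b ≠ 1/2. Then the function F(s, f, a/b) = ∑_{n=0}^∞ f(n)/(n + a/b)^s has infinitely many zeros s with Re(s) > 1. -/

import Mathlib

section

open Filter Topology

open ArithmeticFunction.vonMangoldt in
theorem not_summable_inv_primes_residueClass {M : ℕ} [NeZero M] {a : ZMod M} (ha : IsUnit a) :
    ¬ Summable fun n : ℕ ↦ if n.Prime ∧ (n : ZMod M) = a then (n : ℝ)⁻¹ else 0 := by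
  set u : ℕ → ℝ := fun n ↦ if n.Prime ∧ (n : ZMod M) = a then (n : ℝ)⁻¹ else 0 with hu
  intro hsum
  have hu0 (n : ℕ) : 0 ≤ u n := by simp only [hu]; positivity
  obtain ⟨C, hC⟩ := LSeries_residueClass_lower_bound ha
  set c : ℝ := (M.totient : ℝ)⁻¹ with hc
  have hc0 : 0 < c := inv_pos.mpr (by exact_mod_cast Nat.totient_pos.mpr (NeZero.pos M))
  obtain ⟨T, hT⟩ : ∃ T : Finset ℕ, ∑' n, (T : Set ℕ)ᶜ.indicator u n < c / 2 := by
    have := (tendsto_tsum_compl_atTop_zero u).eventually_lt_const (half_pos hc0)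
    obtain ⟨T, hT⟩ := this.exists
    refine ⟨T, ?_⟩
    rw [← tsum_subtype]
    exact hT
  set v : ℕ → ℝ := fun n ↦ (if n.Prime then 0 else residueClass a n) / n with hv
  have hvs : Summable v := summable_residueClass_non_primes_div a
  set w : ℕ → ℝ := fun n ↦ (T : Set ℕ).indicator (fun n : ℕ ↦ u n * Real.log n) n with hw
  have hws : Summable w := by
    apply summable_of_hasFiniteSupport
    exact T.finite_toSet.subset Set.support_indicator_subset
  have hws' : Summable ((T : Set ℕ)ᶜ.indicator u) := hsum.indicator _
  have key : ∀ x ∈ Set.Ioc (1 : ℝ) 2, c / (x - 1) - C ≤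
      ∑' n, v n + ∑' n, w n + (c / 2) / (x - 1) := by
    intro x hx
    have hx1 : 0 < x - 1 := sub_pos.mpr hx.1
    have hterm (n : ℕ) : residueClass a n / (n : ℝ) ^ x ≤
        v n + w n + (T : Set ℕ)ᶜ.indicator u n * (1 / (x - 1)) := by
      rcases Nat.eq_zero_or_pos n with rfl | hn
      · have h1 : u 0 = 0 := by simp [hu]
        simp [hv, hw, Set.indicator, h1]
      have hn1 : (1 : ℝ) ≤ n := by exact_mod_cast hn
      have hn0 : (0 : ℝ) < n := by linarith
      have hle : (n : ℝ) ≤ (n : ℝ) ^ x := by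
        simpa using Real.rpow_le_rpow_of_exponent_le hn1 hx.1.le
      have hlog : 0 ≤ Real.log n := Real.log_nonneg hn1
      by_cases hp : n.Prime
      · have hv0 : v n = 0 := by simp [hv, hp]
        by_cases hna : (n : ZMod M) = a
        · have hr : residueClass a n = Real.log n := by
            rw [residueClass, Set.indicator_of_mem (by exact hna),
              ArithmeticFunction.vonMangoldt_apply_prime hp]
          have hun : u n = (n : ℝ)⁻¹ := by simp [hu, hp, hna]
          rw [hr, hv0]
          by_cases hnT : n ∈ (T : Set ℕ)
          · have : w n = (n : ℝ)⁻¹ * Real.log n := by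
              simp only [hw, Set.indicator_of_mem hnT, hun]
            rw [this, Set.indicator_of_notMem (by simpa using hnT)]
            have : Real.log n / (n : ℝ) ^ x ≤ Real.log n / n := by gcongr
            rw [div_eq_mul_inv _ (n : ℝ)] at this
            linarith
          · have h0 : w n = 0 := by simp only [hw, Set.indicator_of_notMem hnT]
            rw [h0, Set.indicator_of_mem (by simpa using hnT), hun]
            have h1 : Real.log n ≤ (n : ℝ) ^ (x - 1) / (x - 1) :=
              Real.log_le_rpow_div hn0.le hx1
            have h2 : (n : ℝ) ^ x = (n : ℝ) ^ (x - 1) * n := by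
              rw [← Real.rpow_add_one hn0.ne']; ring_nf
            rw [h2]
            have h3 : 0 < (n : ℝ) ^ (x - 1) := Real.rpow_pos_of_pos hn0 _
            calc Real.log n / ((n : ℝ) ^ (x - 1) * n)
                ≤ ((n : ℝ) ^ (x - 1) / (x - 1)) / ((n : ℝ) ^ (x - 1) * n) := by gcongr
              _ = 0 + 0 + (n : ℝ)⁻¹ * (1 / (x - 1)) := by field_simp; ring
        · have hr : residueClass a n = 0 := by
            rw [residueClass, Set.indicator_of_notMem (by exact hna)]
          have hun : u n = 0 := by simp [hu, hna]
          have h0 : w n = 0 := by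
            simp only [hw, Set.indicator_apply, hun, zero_mul, ite_self]
          have h1 : (T : Set ℕ)ᶜ.indicator u n = 0 := by
            simp only [Set.indicator_apply, hun, ite_self]
          simp [hr, hv0, h0, h1]
      · have hun : u n = 0 := by simp [hu, hp]
        have h0 : w n = 0 := by
          simp only [hw, Set.indicator_apply, hun, zero_mul, ite_self]
        have h1 : (T : Set ℕ)ᶜ.indicator u n = 0 := by
          simp only [Set.indicator_apply, hun, ite_self]
        have hvn : v n = residueClass a n / n := by simp [hv, hp]
        rw [h0, h1, hvn]
        have := residueClass_nonneg a n
        have : residueClass a n / (n : ℝ) ^ x ≤ residueClass a n / n := by gcongr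
        linarith
    have hs := (hvs.add hws).add (hws'.mul_right (1 / (x - 1)))
    have hs' : Summable fun n : ℕ ↦ residueClass a n / (n : ℝ) ^ x :=
      Summable.of_nonneg_of_le (fun n ↦ div_nonneg (residueClass_nonneg a n) (by positivity))
        hterm hs
    have h := (hC hx).trans (hs'.tsum_le_tsum hterm hs)
    rw [(hvs.add hws).tsum_add (hws'.mul_right _), hvs.tsum_add hws, tsum_mul_right] at h
    have h5 : (∑' n, (T : Set ℕ)ᶜ.indicator u n) * (1 / (x - 1)) ≤ (c / 2) / (x - 1) := by
      rw [mul_one_div]; gcongr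
    linarith
  set K : ℝ := ∑' n, v n + ∑' n, w n + C with hK
  set y : ℝ := min 1 (c / (2 * (|K| + 1))) with hy
  have hK1 : 0 < |K| + 1 := by positivity
  have hy0 : 0 < y := lt_min one_pos (by positivity)
  have h := key (1 + y) ⟨by linarith, by linarith [min_le_left 1 (c / (2 * (|K| + 1)))]⟩
  have h1 : c / 2 / y ≤ K := by
    have : c / y = c / 2 / y + c / 2 / y := by ring
    simp only [add_sub_cancel_left] at h
    linarith
  have h2 : |K| + 1 ≤ c / 2 / y := by
    rw [le_div_iff₀ hy0]
    calc (|K| + 1) * y ≤ (|K| + 1) * (c / (2 * (|K| + 1))) := by gcongr; exact min_le_right _ _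
      _ = c / 2 := by field_simp
  linarith [le_abs_self K]

open Complex in
theorem tendsto_mean_exp_mul_I (T μ : ℝ) :
    Tendsto (fun X : ℝ ↦ (X : ℂ)⁻¹ * ∫ t in T..T + X, cexp (μ * t * I)) atTop
      (𝓝 (if μ = 0 then 1 else 0)) := by
  split_ifs with h
  · refine tendsto_const_nhds.congr' ?_
    filter_upwards [eventually_gt_atTop 0] with X hX
    have : (X : ℂ) ≠ 0 := by exact_mod_cast hX.ne'
    simp [h, this]
  · have hμ : (μ : ℂ) * I ≠ 0 := by simp [h]
    have hb : ∀ X : ℝ, ‖∫ t in T..T + X, cexp (μ * t * I)‖ ≤ 2 / |μ| := by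
      intro X
      have h1 : ∀ t : ℝ, cexp (μ * t * I) = cexp (μ * I * t) := fun t ↦ by ring_nf
      simp_rw [h1]
      rw [integral_exp_mul_complex hμ, norm_div]
      have h2 : ‖(μ : ℂ) * I‖ = |μ| := by simp
      have h3 (t : ℝ) : ‖cexp (μ * I * t)‖ = 1 := by
        rw [← h1, ← ofReal_mul, norm_exp_ofReal_mul_I]
      rw [h2]
      gcongr
      calc _ ≤ _ := norm_sub_le _ _
        _ = 2 := by rw [h3, h3]; norm_num
    rw [tendsto_zero_iff_norm_tendsto_zero]
    refine squeeze_zero' (g := fun X : ℝ ↦ X⁻¹ * (2 / |μ|)) (.of_forall fun X ↦ norm_nonneg _) ?_ ?_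
    · filter_upwards [eventually_gt_atTop 0] with X hX
      rw [norm_mul, norm_inv, norm_real, Real.norm_of_nonneg hX.le]
      gcongr
      exact hb X
    · simpa using tendsto_inv_atTop_zero.mul_const (2 / |μ|)

open Complex ComplexConjugate in
theorem tendsto_mean_normSq_sum_exp {J : Type*} [Fintype J] (T : ℝ) {μ : J → ℝ}
    (hμ : Function.Injective μ) (c : J → ℂ) :
    Tendsto (fun X : ℝ ↦ X⁻¹ * ∫ t in T..T + X, ‖∑ j, c j * cexp (μ j * t * I)‖ ^ 2) atTop
      (𝓝 (∑ j, ‖c j‖ ^ 2)) := by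
  classical
  have hexp (t : ℝ) : ((‖∑ j, c j * cexp (μ j * t * I)‖ ^ 2 : ℝ) : ℂ) =
      ∑ j, ∑ l, c j * conj (c l) * cexp ((μ j - μ l : ℝ) * t * I) := by
    rw [ofReal_pow, ← mul_conj', map_sum, Finset.sum_mul_sum]
    refine Finset.sum_congr rfl fun j _ ↦ Finset.sum_congr rfl fun l _ ↦ ?_
    rw [map_mul, ← exp_conj, mul_mul_mul_comm, ← Complex.exp_add]
    simp only [map_mul, conj_ofReal, conj_I, ofReal_sub]
    ring_nf
  rw [← Filter.tendsto_ofReal_iff]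
  have hlim : Tendsto (fun X : ℝ ↦ ∑ j, ∑ l, c j * conj (c l) *
      ((X : ℂ)⁻¹ * ∫ t in T..T + X, cexp ((μ j - μ l : ℝ) * t * I))) atTop
      (𝓝 (∑ j, ∑ l, c j * conj (c l) * (if μ j - μ l = 0 then 1 else 0))) :=
    tendsto_finsetSum _ fun j _ ↦ tendsto_finsetSum _ fun l _ ↦
      (tendsto_mean_exp_mul_I T _).const_mul _
  convert hlim using 2 with X
  · push_cast [← intervalIntegral.integral_ofReal]
    simp_rw [← ofReal_pow, hexp]
    rw [intervalIntegral.integral_finsetSum, Finset.mul_sum]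
    · refine Finset.sum_congr rfl fun j _ ↦ ?_
      rw [intervalIntegral.integral_finsetSum, Finset.mul_sum]
      · refine Finset.sum_congr rfl fun l _ ↦ ?_
        rw [intervalIntegral.integral_const_mul]
        push_cast
        ring
      · intro l _
        exact Continuous.intervalIntegrable (by fun_prop) _ _
    · intro j _
      exact Continuous.intervalIntegrable (by fun_prop) _ _
  · push_cast
    refine Finset.sum_congr rfl fun j _ ↦ ?_
    simp [sub_eq_zero, hμ.eq_iff, mul_conj']

open Complex ComplexConjugate in
/-- **Kronecker's approximation theorem** -/
theorem kronecker_approximation {ι : Type*} [Fintype ι] {ω : ι → ℝ}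
    (hω : Function.Injective fun c : ι → ℕ ↦ ∑ i, c i * ω i)
    {θ : ι → ℂ} (hθ : ∀ i, ‖θ i‖ = 1) {ε : ℝ} (hε : 0 < ε) (T : ℝ) :
    ∃ t > T, ∀ i, ‖cexp (ω i * t * I) - θ i‖ < ε := by
  classical
  by_contra! hcon
  set r := Fintype.card ι with hr
  wlog hε1 : ε ≤ 1 generalizing ε
  · exact this one_pos (fun t ht ↦ (hcon t ht).imp fun i hi ↦ by linarith) le_rfl
  set ρ : ℝ := 1 - ε ^ 2 / 4 with hρ
  have hρ0 : 0 ≤ ρ := by nlinarith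
  have hρ1 : ρ < 1 := by nlinarith
  have hpar (i : ι) (t : ℝ) : ‖1 + conj (θ i) * cexp (ω i * t * I)‖ ^ 2 =
      4 - ‖cexp (ω i * t * I) - θ i‖ ^ 2 := by
    have h1 : cexp (ω i * t * I) - θ i = - θ i * (1 - conj (θ i) * cexp (ω i * t * I)) := by
      have : θ i * conj (θ i) = 1 := by rw [mul_conj']; simp [hθ]
      linear_combination (-cexp (ω i * t * I)) * this
    have h2 : ‖conj (θ i) * cexp (ω i * t * I)‖ = 1 := by
      rw [norm_mul, RCLike.norm_conj, hθ, ← ofReal_mul, norm_exp_ofReal_mul_I, one_mul]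
    have h3 := parallelogram_law_with_norm ℝ (1 : ℂ) (conj (θ i) * cexp (ω i * t * I))
    rw [h1, norm_mul, norm_neg, hθ, one_mul]
    rw [h2, norm_one] at h3
    linarith
  have hbound (k : ℕ) (t : ℝ) (ht : T < t) :
      ‖∏ i, (1 + conj (θ i) * cexp (ω i * t * I)) ^ k‖ ^ 2 ≤ (4 ^ k) ^ r * ρ ^ k := by
    obtain ⟨i₀, hi₀⟩ := hcon t ht
    rw [norm_prod, ← Finset.prod_pow, ← Finset.mul_prod_erase _ _ (Finset.mem_univ i₀)]
    have hr1 : r = (Finset.univ.erase i₀).card + 1 := by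
      rw [Finset.card_erase_add_one (Finset.mem_univ _)]; rfl
    have h1 (i : ι) : ‖(1 + conj (θ i) * cexp (ω i * t * I)) ^ k‖ ^ 2 ≤ 4 ^ k := by
      rw [norm_pow, pow_right_comm, hpar]
      exact pow_le_pow_left₀ (by rw [← hpar]; positivity) (by nlinarith [sq_nonneg ‖cexp (ω i * t * I) - θ i‖]) _
    have h2 : ‖(1 + conj (θ i₀) * cexp (ω i₀ * t * I)) ^ k‖ ^ 2 ≤ 4 ^ k * ρ ^ k := by
      rw [norm_pow, pow_right_comm, hpar, ← mul_pow]
      exact pow_le_pow_left₀ (by rw [← hpar]; positivity) (by nlinarith) _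
    calc _ ≤ (4 ^ k * ρ ^ k) * ∏ i ∈ Finset.univ.erase i₀, (4 : ℝ) ^ k := by
          gcongr with i _
          exact h1 i
      _ = _ := by rw [Finset.prod_const, hr1]; ring
  have hmean (k : ℕ) : ((k.centralBinom : ℝ)) ^ r ≤ (4 ^ k) ^ r * ρ ^ k := by
    set c : (ι → Fin (k + 1)) → ℂ := fun j ↦ ∏ i, ((k.choose (j i) : ℂ) * conj (θ i) ^ (j i : ℕ))
    set μ : (ι → Fin (k + 1)) → ℝ := fun j ↦ ∑ i, ((j i : ℕ) : ℝ) * ω i with hμ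
    have hμi : Function.Injective μ := fun j l hjl ↦ by
      have := hω (a₁ := fun i ↦ (j i : ℕ)) (a₂ := fun i ↦ (l i : ℕ)) hjl
      funext i
      exact Fin.ext (congrFun this i)
    have hA (t : ℝ) : ∏ i, (1 + conj (θ i) * cexp (ω i * t * I)) ^ k =
        ∑ j, c j * cexp (μ j * t * I) := by
      have h1 (i : ι) : (1 + conj (θ i) * cexp (ω i * t * I)) ^ k =
          ∑ m : Fin (k + 1), (k.choose m : ℂ) * conj (θ i) ^ (m : ℕ) *
            cexp (m * ω i * t * I) := by
        rw [add_comm, add_pow, Finset.sum_range]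
        refine Finset.sum_congr rfl fun m _ ↦ ?_
        rw [one_pow, mul_one, mul_pow, ← Complex.exp_nat_mul]
        ring_nf
      simp_rw [h1]
      rw [Finset.prod_univ_sum, Fintype.piFinset_univ]
      refine Finset.sum_congr rfl fun j _ ↦ ?_
      rw [Finset.prod_mul_distrib, ← Complex.exp_sum]
      congr 2
      simp only [hμ, ofReal_sum, Finset.sum_mul, ofReal_mul, ofReal_natCast]
    have hc : ∑ j, ‖c j‖ ^ 2 = (k.centralBinom : ℝ) ^ r := by
      have h1 (j : ι → Fin (k + 1)) : ‖c j‖ ^ 2 = ∏ i, ((k.choose (j i) : ℝ)) ^ 2 := by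
        simp only [c, norm_prod, norm_mul, norm_pow, RCLike.norm_conj, hθ, one_pow, mul_one,
          Complex.norm_natCast, Finset.prod_pow]
      simp_rw [h1]
      rw [← Fintype.piFinset_univ, ← Finset.prod_univ_sum (fun _ ↦ Finset.univ)
        (fun _ (m : Fin (k + 1)) ↦ ((k.choose m : ℝ)) ^ 2), Finset.prod_const,
        ← Finset.sum_range (fun m ↦ ((k.choose m : ℝ)) ^ 2)]
      congr 1
      rw [Nat.centralBinom_eq_two_mul_choose, ← Nat.sum_range_choose_sq]
      push_cast
      rfl
    rw [← hc]
    refine le_of_tendsto (tendsto_mean_normSq_sum_exp T hμi c) ?_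
    filter_upwards [eventually_gt_atTop 0] with X hX
    rw [inv_mul_le_iff₀ hX]
    calc _ ≤ ∫ t in T..T + X, (4 ^ k) ^ r * ρ ^ k := by
          refine intervalIntegral.integral_mono_on_of_le_Ioo (by linarith)
            (Continuous.intervalIntegrable (by fun_prop) _ _)
            (Continuous.intervalIntegrable (by fun_prop) _ _) fun t ht ↦ ?_
          rw [← hA]
          exact hbound k t ht.1
      _ = _ := by simp; ring
  have hlow (k : ℕ) (hk : 0 < k) : 1 ≤ (2 : ℝ) ^ r * (k ^ r * ρ ^ k) := by
    have h1 : (4 : ℝ) ^ k ≤ 2 * k * k.centralBinom := by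
      exact_mod_cast Nat.four_pow_le_two_mul_self_mul_centralBinom k hk
    have h2 : ((4 : ℝ) ^ k) ^ r ≤ (4 ^ k) ^ r * (2 ^ r * (k ^ r * ρ ^ k)) :=
      calc ((4 : ℝ) ^ k) ^ r ≤ (2 * k * k.centralBinom) ^ r := by gcongr
        _ = (2 * k) ^ r * (k.centralBinom : ℝ) ^ r := mul_pow _ _ _
        _ ≤ (2 * k) ^ r * ((4 ^ k) ^ r * ρ ^ k) := by gcongr; exact hmean k
        _ = _ := by rw [mul_pow]; ring
    exact (le_mul_iff_one_le_right (by positivity)).mp h2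
  have hlim := (tendsto_pow_const_mul_const_pow_of_lt_one r hρ0 hρ1).const_mul ((2 : ℝ) ^ r)
  rw [mul_zero] at hlim
  obtain ⟨k, hk, hk'⟩ := ((hlim.eventually_lt_const one_pos).and (eventually_gt_atTop 0)).exists
  exact absurd (hlow k hk') (not_le.mpr hk)

open Complex in
theorem exists_tendsto_prime_cpow {h : ℕ → ℂ} (hh : ∀ p : ℕ, p.Prime → ‖h p‖ = 1) :
    ∃ τ : ℕ → ℝ, Tendsto τ atTop atTop ∧
      ∀ p : ℕ, p.Prime → Tendsto (fun k ↦ (p : ℂ) ^ (-(τ k * I))) atTop (𝓝 (h p)) := by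
  have key (k : ℕ) : ∃ t > (k : ℝ), ∀ p < k, p.Prime →
      ‖(p : ℂ) ^ (-(t * I)) - h p‖ < ((k : ℝ) + 1)⁻¹ := by
    let ι := {p : Fin k // (p : ℕ).Prime}
    have hinj : Function.Injective fun c : ι → ℕ ↦ ∑ i, c i * (-Real.log (i : ℕ)) := by
      intro c d hcd
      have hprod (c : ι → ℕ) : Real.log (∏ i : ι, (i : ℕ) ^ c i : ℕ) =
          ∑ i : ι, c i * Real.log (i : ℕ) := by
        push_cast
        rw [Real.log_prod]
        · simp [Real.log_pow]
        · exact fun i _ ↦ pow_ne_zero _ (by exact_mod_cast i.2.ne_zero)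
      have hpos (c : ι → ℕ) : 0 < ∏ i : ι, (i : ℕ) ^ c i :=
        Finset.prod_pos fun i _ ↦ pow_pos i.2.pos _
      have hfac (c : ι → ℕ) (j : ι) : (∏ i : ι, (i : ℕ) ^ c i).factorization (j : ℕ) = c j := by
        rw [Nat.factorization_prod fun i _ ↦ pow_ne_zero _ i.2.ne_zero, Finsupp.finsetSum_apply,
          Finset.sum_eq_single j]
        · simp [j.2.factorization_pow]
        · intro i _ hij
          rw [i.2.factorization_pow, Finsupp.single_apply, if_neg]
          exact fun hh ↦ hij (Subtype.ext (Fin.ext hh))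
        · simp
      have hlog : Real.log (∏ i : ι, (i : ℕ) ^ c i : ℕ) = Real.log (∏ i : ι, (i : ℕ) ^ d i : ℕ) := by
        rw [hprod, hprod]
        simpa using hcd
      have := Real.log_injOn_pos (Set.mem_Ioi.mpr (Nat.cast_pos.mpr (hpos c)))
        (Set.mem_Ioi.mpr (Nat.cast_pos.mpr (hpos d))) hlog
      funext j
      rw [← hfac c j, ← hfac d j, Nat.cast_injective this]
    obtain ⟨t, ht, hti⟩ := kronecker_approximation hinj (θ := fun i : ι ↦ h (i : ℕ))
      (fun i ↦ hh _ i.2) (ε := ((k : ℝ) + 1)⁻¹) (by positivity) k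
    refine ⟨t, ht, fun p hp hpp ↦ ?_⟩
    convert hti ⟨⟨p, hp⟩, hpp⟩ using 3
    rw [cpow_def_of_ne_zero (by exact_mod_cast hpp.ne_zero), ← natCast_log]
    push_cast
    ring_nf
  choose τ hτ hτp using key
  refine ⟨τ, tendsto_atTop_mono (fun k ↦ (hτ k).le) tendsto_natCast_atTop_atTop, fun p hp ↦ ?_⟩
  rw [tendsto_iff_norm_sub_tendsto_zero]
  refine squeeze_zero' (.of_forall fun _ ↦ norm_nonneg _) ?_
    (g := fun k : ℕ ↦ ((k : ℝ) + 1)⁻¹) ?_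
  · filter_upwards [eventually_gt_atTop p] with k hk
    exact (hτp k p hk hp).le
  · simpa using tendsto_one_div_add_atTop_nhds_zero_nat (𝕜 := ℝ)

/-- A limit of holomorphic functions with an isolated zero forces zeros of the approximants. -/
theorem TendstoLocallyUniformlyOn.eventually_exists_zero {ι : Type*} {l : Filter ι}
    {F : ι → ℂ → ℂ} {H : ℂ → ℂ} {U : Set ℂ} (hlim : TendstoLocallyUniformlyOn F H l U)
    (hU : IsOpen U) (hF : ∀ᶠ i in l, DifferentiableOn ℂ (F i) U) (hH : DifferentiableOn ℂ H U)
    {c : ℂ} (hc : c ∈ U) (hc0 : H c = 0) (hne : ¬ ∀ᶠ z in 𝓝 c, H z = 0) :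
    ∀ᶠ i in l, ∃ z ∈ U, F i z = 0 := by
  have hne' : ∀ᶠ z in 𝓝[≠] c, H z ≠ 0 :=
    ((hH.analyticAt (hU.mem_nhds hc)).eventually_eq_zero_or_eventually_ne_zero).resolve_left hne
  rw [eventually_nhdsWithin_iff] at hne'
  obtain ⟨r, hr, hball⟩ := Metric.nhds_basis_closedBall.eventually_iff.mp
    (hne'.and (hU.eventually_mem hc))
  have hsub : Metric.closedBall c r ⊆ U := fun z hz ↦ (hball hz).2
  have hsph : IsCompact (Metric.sphere c r) := isCompact_sphere c r
  obtain ⟨w, hw, hmin⟩ := hsph.exists_isMinOn (NormedSpace.sphere_nonempty.mpr hr.le)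
    ((hH.continuousOn.mono (Metric.sphere_subset_closedBall.trans hsub)).norm)
  have hw0 : 0 < ‖H w‖ := norm_pos_iff.mpr <|
    (hball (Metric.sphere_subset_closedBall hw)).1 (Metric.ne_of_mem_sphere hw hr.ne')
  have hunif := (tendstoLocallyUniformlyOn_iff_forall_isCompact hU).mp hlim _ hsub
    (isCompact_closedBall c r)
  filter_upwards [Metric.tendstoUniformlyOn_iff.mp hunif _ (half_pos hw0), hF] with i hi hFi
  by_contra! hcon
  have hd : DiffContOnCl ℂ (F i)⁻¹ (Metric.ball c r) := by
    refine DiffContOnCl.inv (hFi.mono ?_).diffContOnCl fun z hz ↦ ?_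
    · rwa [closure_ball c hr.ne']
    · rw [closure_ball c hr.ne'] at hz
      exact hcon z (hsub hz)
  have hle := Complex.norm_le_of_forall_mem_frontier_norm_le Metric.isBounded_ball hd
    (C := (‖H w‖ / 2)⁻¹) (fun z hz ↦ ?_) (subset_closure (Metric.mem_ball_self hr))
  · have h1 := hi c (Metric.mem_closedBall_self hr.le)
    rw [hc0, dist_zero_left] at h1
    have h2 : 0 < ‖F i c‖ := norm_pos_iff.mpr (hcon c hc)
    rw [Pi.inv_apply, norm_inv, inv_le_inv₀ h2 (half_pos hw0)] at hle
    linarith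
  · rw [frontier_ball c hr.ne'] at hz
    have h1 := hi z (Metric.sphere_subset_closedBall hz)
    have h2 : ‖H w‖ ≤ ‖H z‖ := hmin hz
    have h3 : ‖H z‖ - ‖F i z‖ ≤ dist (H z) (F i z) := by
      rw [dist_eq_norm]; exact norm_sub_norm_le _ _
    rw [Pi.inv_apply, norm_inv]
    gcongr
    linarith

/-- The completely multiplicative function with prescribed values at the primes. -/
noncomputable def complMul (z : ℕ → ℂ) (n : ℕ) : ℂ :=
  ∏ p ∈ n.primeFactors, z p ^ n.factorization p

theorem complMul_prime_mul (z : ℕ → ℂ) {p n : ℕ} (hp : p.Prime) (hn : n ≠ 0) :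
    complMul z (p * n) = z p * complMul z n := by
  have h (m : ℕ) : complMul z m = m.factorization.prod fun q k ↦ z q ^ k := by
    rw [Nat.prod_factorization_eq_prod_primeFactors]; rfl
  rw [h, h, Nat.factorization_mul hp.ne_zero hn, Finsupp.prod_add_index', hp.factorization]
  · simp
  · simp
  · exact fun _ _ _ ↦ pow_add _ _ _

theorem norm_complMul_le_one {z : ℕ → ℂ} (hz : ∀ p, p.Prime → ‖z p‖ ≤ 1) (n : ℕ) :
    ‖complMul z n‖ ≤ 1 := by
  rw [complMul, norm_prod]
  refine Finset.prod_le_one (fun _ _ ↦ norm_nonneg _) fun p hp ↦ ?_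
  rw [norm_pow]
  exact pow_le_one₀ (norm_nonneg _) (hz p (Nat.prime_of_mem_primeFactors hp))

theorem complMul_eq_one {z : ℕ → ℂ} {n : ℕ} (hz : ∀ p ∈ n.primeFactors, z p = 1) :
    complMul z n = 1 :=
  Finset.prod_eq_one fun p hp ↦ by rw [hz p hp, one_pow]

theorem complMul_eq_zero {z : ℕ → ℂ} {n p : ℕ} (hp : p ∈ n.primeFactors) (hz : z p = 0) :
    complMul z n = 0 := by
  refine Finset.prod_eq_zero hp ?_
  rw [hz, zero_pow]
  rwa [← Finsupp.mem_support_iff, Nat.support_factorization]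

theorem complMul_cpow (s : ℂ) {n : ℕ} (hn : n ≠ 0) :
    complMul (fun p ↦ (p : ℂ) ^ s) n = (n : ℂ) ^ s := by
  induction n using induction_on_primes with
  | zero => exact absurd rfl hn
  | one => simp [complMul]
  | prime_mul p m hp ih =>
    have hm : m ≠ 0 := right_ne_zero_of_mul hn
    rw [complMul_prime_mul _ hp hm, ih hm, Nat.cast_mul, Complex.natCast_mul_natCast_cpow]

theorem LSeriesSummable_of_norm_le {g : ℕ → ℂ} {C : ℝ} (hg : ∀ n, ‖g n‖ ≤ C) {s : ℂ}
    (hs : 1 < s.re) : LSeriesSummable g s :=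
  LSeriesSummable_of_bounded_of_one_lt_re (fun n _ ↦ hg n) hs

theorem LSeries_differentiableOn_of_norm_le {g : ℕ → ℂ} {C : ℝ} (hg : ∀ n, ‖g n‖ ≤ C) :
    DifferentiableOn ℂ (LSeries g) {s | 1 < s.re} := by
  refine (LSeries_differentiableOn g).mono fun s hs ↦ ?_
  exact (LSeries.abscissaOfAbsConv_le_of_le_const ⟨C, fun n _ ↦ hg n⟩).trans_lt
    (by exact_mod_cast hs)

theorem norm_LSeries_sub_le {u v : ℕ → ℂ} {s s' : ℂ} {w : ℕ → ℝ} (hu : LSeriesSummable u s)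
    (hv : LSeriesSummable v s') (hw : Summable w)
    (h : ∀ n, ‖LSeries.term u s n - LSeries.term v s' n‖ ≤ w n) :
    ‖LSeries u s - LSeries v s'‖ ≤ ∑' n, w n := by
  rw [LSeries, LSeries, ← hu.tsum_sub hv]
  exact tsum_of_norm_bounded hw.hasSum h

theorem norm_mul_complMul_le {g : ℕ → ℂ} {C : ℝ} (hg : ∀ n, ‖g n‖ ≤ C) {z : ℕ → ℂ}
    (hz : ∀ p, p.Prime → ‖z p‖ ≤ 1) (n : ℕ) : ‖g n * complMul z n‖ ≤ C := by
  rw [norm_mul]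
  exact (mul_le_of_le_one_right (norm_nonneg _) (norm_complMul_le_one hz n)).trans (hg n)

open Complex in
theorem exists_zero_im_gt_of_complMul_zero {g : ℕ → ℂ} {C : ℝ} (hg : ∀ n, ‖g n‖ ≤ C)
    {z : ℕ → ℂ} (hz : ∀ p : ℕ, p.Prime → ‖z p‖ = 1) {s₁ : ℂ} (hs₁ : 1 < s₁.re)
    (h₁ : LSeries (fun n ↦ g n * complMul z n) s₁ = 0) {s₂ : ℂ} (hs₂ : 1 < s₂.re)
    (h₂ : LSeries (fun n ↦ g n * complMul z n) s₂ ≠ 0) (T : ℝ) :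
    ∃ s : ℂ, T < s.im ∧ 1 < s.re ∧ LSeries g s = 0 := by
  set H := LSeries fun n ↦ g n * complMul z n with hH
  have hC : 0 ≤ C := (norm_nonneg _).trans (hg 0)
  have hgz := norm_mul_complMul_le hg fun p hp ↦ (hz p hp).le
  have hHd : DifferentiableOn ℂ H {s | 1 < s.re} := LSeries_differentiableOn_of_norm_le hgz
  have hopen (x : ℝ) : IsOpen {s : ℂ | x < s.re} := isOpen_lt continuous_const continuous_re
  have hne : ¬ ∀ᶠ s in 𝓝 s₁, H s = 0 := fun hev ↦ h₂ <|
    (hHd.analyticOnNhd (hopen 1)).eqOn_zero_of_preconnected_of_eventuallyEq_zero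
      (convex_halfSpace_re_gt 1).isPreconnected hs₁ hev hs₂
  obtain ⟨τ, hτ, hτp⟩ := exists_tendsto_prime_cpow hz
  have hτn {n : ℕ} (hn : n ≠ 0) :
      Tendsto (fun k ↦ (n : ℂ) ^ (-(τ k * I))) atTop (𝓝 (complMul z n)) := by
    simp_rw [← complMul_cpow _ hn]
    exact tendsto_finsetProd _ fun p hp ↦ (hτp p (Nat.prime_of_mem_primeFactors hp)).pow _
  have hnorm (n : ℕ) (hn : n ≠ 0) (t : ℝ) : ‖(n : ℂ) ^ (-(t * I))‖ = 1 := by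
    rw [norm_natCast_cpow_of_pos (Nat.pos_of_ne_zero hn)]; simp
  have hlim : TendstoLocallyUniformlyOn (fun k s ↦ LSeries g (s + τ k * I)) H atTop
      {s | 1 < s.re} := by
    rw [Metric.tendstoLocallyUniformlyOn_iff]
    intro ε hε x hx
    obtain ⟨σ, hσ1, hσx⟩ := exists_between (Set.mem_ofPred.mp hx)
    refine ⟨{s | σ < s.re}, mem_nhdsWithin_of_mem_nhds ((hopen σ).mem_nhds hσx), ?_⟩
    set e : ℕ → ℕ → ℝ := fun k n ↦
      C * ‖complMul z n - (n : ℂ) ^ (-(τ k * I))‖ * ((n : ℝ) ^ σ)⁻¹ with he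
    have hsum : Summable fun n : ℕ ↦ C * 2 * ((n : ℝ) ^ σ)⁻¹ :=
      (Real.summable_nat_rpow_inv.mpr hσ1).mul_left _
    have hle (k n : ℕ) : ‖e k n‖ ≤ C * 2 * ((n : ℝ) ^ σ)⁻¹ := by
      rw [Real.norm_of_nonneg (by positivity)]
      rcases eq_or_ne n 0 with rfl | hn
      · simp [he, Real.zero_rpow (by linarith : σ ≠ 0)]
      · simp only [he]
        gcongr
        refine (norm_sub_le _ _).trans ?_
        rw [hnorm n hn]
        linarith [norm_complMul_le_one (fun p hp ↦ (hz p hp).le) n]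
    have hten : Tendsto (fun k ↦ ∑' n, e k n) atTop (𝓝 (∑' _ : ℕ, 0)) := by
      refine tendsto_tsum_of_dominated_convergence hsum (fun n ↦ ?_) (.of_forall fun k n ↦ hle k n)
      rcases eq_or_ne n 0 with rfl | hn
      · simp [he, Real.zero_rpow (by linarith : σ ≠ 0)]
      · have h0 : Tendsto (fun k ↦ ‖complMul z n - (n : ℂ) ^ (-(τ k * I))‖) atTop (𝓝 0) := by
          simpa using ((hτn hn).const_sub (complMul z n)).norm
        simpa [he] using (h0.const_mul C).mul_const ((n : ℝ) ^ σ)⁻¹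
    rw [tsum_zero] at hten
    filter_upwards [hten.eventually_lt_const hε] with k hk s hs
    replace hs : σ < s.re := hs
    rw [dist_eq_norm]
    refine (norm_LSeries_sub_le (LSeriesSummable_of_norm_le hgz (hσ1.trans hs))
      (LSeriesSummable_of_norm_le hg (by simpa using hσ1.trans hs))
      (Summable.of_norm_bounded hsum (hle k)) fun n ↦ ?_).trans_lt hk
    rcases eq_or_ne n 0 with rfl | hn
    · simp [he, Real.zero_rpow (by linarith : σ ≠ 0)]
    · have hn0 : (n : ℂ) ≠ 0 := by exact_mod_cast hn
      have hn1 : (1 : ℝ) ≤ n := by exact_mod_cast Nat.one_le_iff_ne_zero.mpr hn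
      have : g n * complMul z n / (n : ℂ) ^ s - g n / (n : ℂ) ^ (s + τ k * I) =
          g n * (complMul z n - (n : ℂ) ^ (-(τ k * I))) * ((n : ℂ) ^ s)⁻¹ := by
        rw [cpow_add _ _ hn0, cpow_neg]
        have := (cpow_ne_zero_iff_of_exponent_ne_zero (x := (n : ℂ))
          (y := s) (fun h ↦ by rw [h, zero_re] at hs; linarith)).mpr hn0
        field_simp
      rw [LSeries.term_of_ne_zero hn, LSeries.term_of_ne_zero hn, this, norm_mul, norm_mul,
        norm_inv, norm_natCast_cpow_of_pos (Nat.pos_of_ne_zero hn)]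
      simp only [he]
      gcongr
      exact hg n
  have hFd (k : ℕ) : DifferentiableOn ℂ (fun s ↦ LSeries g (s + τ k * I)) {s | 1 < s.re} := by
    refine (LSeries_differentiableOn_of_norm_le hg).comp (by fun_prop) fun s hs ↦ ?_
    simpa using hs
  have hU : IsOpen ({s : ℂ | 1 < s.re} ∩ Metric.ball s₁ 1) := (hopen 1).inter Metric.isOpen_ball
  have hz0 := (hlim.mono Set.inter_subset_left).eventually_exists_zero hU
    (.of_forall fun k ↦ (hFd k).mono Set.inter_subset_left) (hHd.mono Set.inter_subset_left)
    ⟨hs₁, Metric.mem_ball_self one_pos⟩ h₁ hne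
  obtain ⟨k, ⟨s, ⟨hs, hsb⟩, hs0⟩, hk⟩ :=
    (hz0.and (hτ.eventually_gt_atTop (T + 1 - s₁.im))).exists
  refine ⟨s + τ k * I, ?_, by simpa using hs, hs0⟩
  have h3 : |(s - s₁).im| < 1 := (abs_im_le_norm _).trans_lt (mem_ball_iff_norm.mp hsb)
  rw [sub_im, abs_lt] at h3
  simp only [add_im, mul_im, ofReal_re, I_im, ofReal_im, I_re]
  linarith [h3.1]

open Complex in
theorem exists_forall_LSeries_mul_ne_zero {g : ℕ → ℂ} {C : ℝ} (hg : ∀ n, ‖g n‖ ≤ C) {m : ℕ}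
    (hm : m ≠ 0) (hgm : g m ≠ 0) (hmin : ∀ n < m, g n = 0) (σ₀ : ℝ) :
    ∃ σ > σ₀, 1 < σ ∧ ∀ (w : ℕ → ℂ) (s : ℂ), (∀ n, ‖w n‖ ≤ 1) → w m = 1 → s.re = σ →
      LSeries (fun n ↦ g n * w n) s ≠ 0 := by
  obtain ⟨k, rfl⟩ := Nat.exists_eq_succ_of_ne_zero hm
  have habs : LSeries.abscissaOfAbsConv (fun n ↦ (‖g n‖ : ℂ)) < ⊤ :=
    (LSeries.abscissaOfAbsConv_le_of_le_const ⟨C, fun n _ ↦ by simpa using hg n⟩).trans_lt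
      (EReal.coe_lt_top 1)
  have hlim := (LSeries.tendsto_cpow_mul_atTop (f := fun n ↦ (‖g n‖ : ℂ)) (n := k)
    (fun n hn ↦ by simp [hmin n (Nat.lt_succ_of_le hn)]) habs).norm
  have hpos : 0 < ‖g (k + 1)‖ := norm_pos_iff.mpr hgm
  have hev := hlim.eventually_lt_const (u := 2 * ‖g (k + 1)‖) (by
    simp only [norm_real, norm_norm]; linarith)
  obtain ⟨σ, ⟨hσ, hσ₀⟩, hσ1⟩ := ((hev.and (eventually_gt_atTop σ₀)).and
    (eventually_gt_atTop 1)).exists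
  refine ⟨σ, hσ₀, hσ1, fun w s hw hw1 hs h0 ↦ ?_⟩
  have hsre : 1 < s.re := hs ▸ hσ1
  have hgw (n : ℕ) : ‖g n * w n‖ ≤ ‖g n‖ := by
    rw [norm_mul]; exact mul_le_of_le_one_right (norm_nonneg _) (hw n)
  have hS : Summable fun n ↦ ‖LSeries.term g σ n‖ :=
    (LSeriesSummable_of_norm_le hg (s := σ) (by simpa using hσ1)).norm
  have hS' : Summable (LSeries.term (fun n ↦ g n * w n) s) :=
    LSeriesSummable_of_norm_le (fun n ↦ (hgw n).trans (hg n)) hsre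
  have hle (n : ℕ) : ‖LSeries.term (fun n ↦ g n * w n) s n‖ ≤ ‖LSeries.term g σ n‖ := by
    rw [LSeries.norm_term_eq, LSeries.norm_term_eq, hs, ofReal_re]
    split_ifs
    · rfl
    · gcongr
      exact hgw n
  have hreal : LSeries (fun n ↦ (‖g n‖ : ℂ)) σ = (∑' n, ‖LSeries.term g σ n‖ : ℝ) := by
    rw [LSeries, ofReal_tsum]
    refine tsum_congr fun n ↦ ?_
    rw [LSeries.norm_term_eq, LSeries.term_def]
    split_ifs
    · simp
    · rw [ofReal_re, ofReal_div, ofReal_cpow (Nat.cast_nonneg _), ofReal_natCast]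
  have hpow : ‖((k : ℂ) + 1) ^ (σ : ℂ)‖ = ((k + 1 : ℕ) : ℝ) ^ σ := by
    have := norm_natCast_cpow_of_pos (Nat.succ_pos k) (σ : ℂ)
    rw [ofReal_re] at this
    exact_mod_cast this
  have hPpos : (0 : ℝ) < ((k + 1 : ℕ) : ℝ) ^ σ := Real.rpow_pos_of_pos (by positivity) _
  rw [norm_mul, hpow, hreal, norm_real, Real.norm_of_nonneg (tsum_nonneg fun _ ↦ norm_nonneg _),
    mul_comm, ← lt_div_iff₀ hPpos] at hσ
  have hterm : ‖LSeries.term g σ (k + 1)‖ = ‖g (k + 1)‖ / ((k + 1 : ℕ) : ℝ) ^ σ := by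
    rw [LSeries.norm_term_eq, if_neg k.succ_ne_zero, ofReal_re]
  have hterm' : ‖LSeries.term (fun n ↦ g n * w n) s (k + 1)‖ =
      ‖g (k + 1)‖ / ((k + 1 : ℕ) : ℝ) ^ σ := by
    rw [LSeries.norm_term_eq, if_neg k.succ_ne_zero, hs, hw1, mul_one]
  rw [hS.tsum_eq_add_tsum_ite (k + 1), hterm] at hσ
  rw [LSeries, hS'.tsum_eq_add_tsum_ite (k + 1), add_eq_zero_iff_eq_neg] at h0
  have h1 := congrArg norm h0
  rw [norm_neg, hterm'] at h1
  have h2 : ‖∑' n, if n = k + 1 then 0 else LSeries.term (fun n ↦ g n * w n) s n‖ ≤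
      ∑' n, if n = k + 1 then 0 else ‖LSeries.term g σ n‖ := by
    refine tsum_of_norm_bounded (Summable.hasSum (hS.of_nonneg_of_le ?_ ?_)) ?_
    · intro n; split_ifs <;> positivity
    · intro n; split_ifs <;> simp
    · intro n; split_ifs <;> simp [hle n]
  rw [mul_div_assoc, two_mul] at hσ
  linarith

/-- A Blaschke factor moving `w` to the origin; the value `1` is left fixed. -/
noncomputable def blaschke (w l : ℂ) : ℂ :=
  if w = 1 then 1 else (w + l) / (1 + (starRingEnd ℂ) w * l)

theorem blaschke_zero (w : ℂ) : blaschke w 0 = w := by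
  simp only [blaschke]; split_ifs with h <;> simp [h]

theorem blaschke_denom_ne_zero {w l : ℂ} (hw : ‖w‖ ≤ 1 / 2) (hl : ‖l‖ ≤ 1) :
    1 + (starRingEnd ℂ) w * l ≠ 0 := by
  intro h
  have h1 : ‖(starRingEnd ℂ) w * l‖ = 1 := by
    rw [← neg_eq_iff_add_eq_zero] at h
    rw [← h]; simp
  rw [norm_mul, RCLike.norm_conj] at h1
  nlinarith [norm_nonneg w, norm_nonneg l]

theorem normSq_blaschke_denom_sub (w l : ℂ) :
    ‖1 + (starRingEnd ℂ) w * l‖ ^ 2 - ‖w + l‖ ^ 2 = (1 - ‖w‖ ^ 2) * (1 - ‖l‖ ^ 2) := by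
  simp only [← Complex.normSq_eq_norm_sq, Complex.normSq_apply, Complex.add_re, Complex.add_im,
    Complex.mul_re, Complex.mul_im, Complex.conj_re, Complex.conj_im, Complex.one_re,
    Complex.one_im]
  ring

theorem norm_blaschke_le_one {w l : ℂ} (hw : w = 1 ∨ ‖w‖ ≤ 1 / 2) (hl : ‖l‖ ≤ 1) :
    ‖blaschke w l‖ ≤ 1 := by
  rw [blaschke]
  split_ifs with h
  · simp
  · replace hw := hw.resolve_left h
    rw [norm_div, div_le_one (norm_pos_iff.mpr (blaschke_denom_ne_zero hw hl))]
    refine (pow_le_pow_iff_left₀ (norm_nonneg _) (norm_nonneg _) two_ne_zero).mp ?_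
    have := normSq_blaschke_denom_sub w l
    have h1 : 0 ≤ 1 - ‖w‖ ^ 2 := by nlinarith [norm_nonneg w]
    have h2 : 0 ≤ 1 - ‖l‖ ^ 2 := by nlinarith [norm_nonneg l]
    nlinarith [mul_nonneg h1 h2]

theorem norm_blaschke_eq_one {w l : ℂ} (hw : w = 1 ∨ ‖w‖ ≤ 1 / 2) (hl : ‖l‖ = 1) :
    ‖blaschke w l‖ = 1 := by
  rw [blaschke]
  split_ifs with h
  · simp
  · replace hw := hw.resolve_left h
    rw [norm_div, div_eq_one_iff_eq (norm_ne_zero_iff.mpr (blaschke_denom_ne_zero hw hl.le))]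
    refine (pow_left_inj₀ (norm_nonneg _) (norm_nonneg _) two_ne_zero).mp ?_
    have := normSq_blaschke_denom_sub w l
    rw [hl] at this
    linarith

theorem differentiableAt_blaschke {w l : ℂ} (hw : w = 1 ∨ ‖w‖ ≤ 1 / 2) (hl : ‖l‖ ≤ 1) :
    DifferentiableAt ℂ (blaschke w) l := by
  by_cases h : w = 1
  · have : blaschke w = fun _ ↦ 1 := funext fun l ↦ by rw [blaschke, if_pos h]
    rw [this]
    fun_prop
  · have : blaschke w = fun l ↦ (w + l) / (1 + (starRingEnd ℂ) w * l) :=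
      funext fun l ↦ by rw [blaschke, if_neg h]
    rw [this]
    exact .div (by fun_prop) (by fun_prop) (blaschke_denom_ne_zero (hw.resolve_left h) hl)

/-- If a family of holomorphic functions on the unit disc has a zero in the disc for one value of
the parameter and none for another, then some member has a zero on the unit circle. -/
theorem exists_zero_norm_eq_one {Ψ : ℂ → ℝ → ℂ} {x y : ℝ} (hxy : x ≤ y)
    (hcont : ContinuousOn (fun q : ℂ × ℝ ↦ Ψ q.1 q.2) (Metric.closedBall 0 1 ×ˢ Set.Icc x y))
    (hdiff : ∀ t ∈ Set.Icc x y, DifferentiableOn ℂ (Ψ · t) (Metric.ball 0 1))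
    (hx : ∃ l ∈ Metric.closedBall (0 : ℂ) 1, Ψ l x = 0)
    (hy : ∀ l ∈ Metric.closedBall (0 : ℂ) 1, Ψ l y ≠ 0) :
    ∃ l : ℂ, ‖l‖ = 1 ∧ ∃ t ∈ Set.Icc x y, Ψ l t = 0 := by
  set D : Set ℂ := Metric.closedBall 0 1 with hD
  have hc : IsCompact (D ×ˢ Set.Icc x y) := (isCompact_closedBall 0 1).prod isCompact_Icc
  have hKc : IsCompact ((D ×ˢ Set.Icc x y) ∩ (fun q : ℂ × ℝ ↦ Ψ q.1 q.2) ⁻¹' {0}) :=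
    hc.of_isClosed_subset (hcont.preimage_isClosed_of_isClosed hc.isClosed isClosed_singleton)
      Set.inter_subset_left
  obtain ⟨l₀, hl₀, hl₀0⟩ := hx
  obtain ⟨⟨l, t⟩, ⟨⟨hl, ht⟩, hl0⟩, hmax⟩ := hKc.exists_isMaxOn
    ⟨(l₀, x), ⟨hl₀, le_rfl, hxy⟩, hl₀0⟩ continuous_snd.continuousOn
  replace hl : l ∈ D := hl
  replace ht : t ∈ Set.Icc x y := ht
  replace hl0 : Ψ l t = 0 := hl0
  have hty : t < y := lt_of_le_of_ne ht.2 fun h ↦ hy l hl (h ▸ hl0)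
  rcases (mem_closedBall_zero_iff.mp hl).eq_or_lt with hl1 | hl1
  · exact ⟨l, hl1, t, ht, hl0⟩
  have hlb : l ∈ Metric.ball (0 : ℂ) 1 := mem_ball_zero_iff.mpr hl1
  by_cases hev : ∀ᶠ l' in 𝓝 l, Ψ l' t = 0
  · have heq : Set.EqOn (Ψ · t) 0 (Metric.ball 0 1) :=
      ((hdiff t ht).analyticOnNhd Metric.isOpen_ball).eqOn_zero_of_preconnected_of_eventuallyEq_zero
        (convex_ball 0 1).isPreconnected hlb hev
    have hct : ContinuousOn (Ψ · t) D :=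
      hcont.comp (f := fun l' : ℂ ↦ (l', t)) (by fun_prop) fun l' hl' ↦ ⟨hl', ht⟩
    have hcl : Set.EqOn (Ψ · t) 0 D := heq.of_subset_closure hct continuousOn_const
      Metric.ball_subset_closedBall (closure_ball (0 : ℂ) one_ne_zero).ge
    exact ⟨1, by simp, t, ht, hcl (by simp [hD])⟩
  · exfalso
    have hIoo : ∀ᶠ t' in 𝓝[>] t, t' ∈ Set.Ioo t y := Ioo_mem_nhdsGT hty
    have hlim : TendstoUniformlyOn (fun t' l' ↦ Ψ l' t') (Ψ · t) (𝓝[>] t) (Metric.ball 0 1) := by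
      rw [Metric.tendstoUniformlyOn_iff]
      intro ε hε
      obtain ⟨δ, hδ, hδε⟩ := Metric.uniformContinuousOn_iff.mp
        (hc.uniformContinuousOn_of_continuous hcont) ε hε
      have hnear : ∀ᶠ t' in 𝓝[>] t, dist t t' < δ :=
        eventually_nhdsWithin_of_eventually_nhds <| by
          filter_upwards [Metric.ball_mem_nhds t hδ] with t' ht'
          rwa [dist_comm]
      filter_upwards [hIoo, hnear] with t' ht' hd l' hl'
      have hl'D := Metric.ball_subset_closedBall hl'
      exact hδε (l', t) ⟨hl'D, ht⟩ (l', t') ⟨hl'D, ht.1.trans ht'.1.le, ht'.2.le⟩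
        (by simpa [Prod.dist_eq] using hd)
    have h1 := hlim.tendstoLocallyUniformlyOn.eventually_exists_zero Metric.isOpen_ball
      (by filter_upwards [hIoo] with t' ht' using hdiff t' ⟨ht.1.trans ht'.1.le, ht'.2.le⟩)
      (hdiff t ht) hlb hl0 hev
    obtain ⟨t', ⟨l', hl', hl0'⟩, ht'⟩ := (h1.and hIoo).exists
    have h2 : t' ≤ t := hmax (a := (l', t')) ⟨⟨Metric.ball_subset_closedBall hl',
      ht.1.trans ht'.1.le, ht'.2.le⟩, hl0'⟩
    exact absurd ht'.1 (not_lt.mpr h2)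

open Complex in
/-- A zero of a twisted L-series persists when the twist is pushed to the unit circle. -/
theorem exists_unimodular_complMul_zero {g : ℕ → ℂ} {C : ℝ} (hg : ∀ n, ‖g n‖ ≤ C) {m : ℕ}
    (hm : m ≠ 0) (hgm : g m ≠ 0) (hmin : ∀ n < m, g n = 0) {z : ℕ → ℂ}
    (hz : ∀ p : ℕ, p.Prime → z p = 1 ∨ ‖z p‖ ≤ 1 / 2) (hzm : ∀ p ∈ m.primeFactors, z p = 1)
    {s₀ : ℂ} (hs₀ : 1 < s₀.re) (h₀ : LSeries (fun n ↦ g n * complMul z n) s₀ = 0) :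
    ∃ w : ℕ → ℂ, (∀ p : ℕ, p.Prime → ‖w p‖ = 1) ∧
      (∃ s, 1 < s.re ∧ LSeries (fun n ↦ g n * complMul w n) s = 0) ∧
      ∃ s, 1 < s.re ∧ LSeries (fun n ↦ g n * complMul w n) s ≠ 0 := by
  set B : ℂ → ℕ → ℂ := fun l p ↦ blaschke (z p) l with hB
  set D : Set ℂ := Metric.closedBall 0 1 with hD
  have hDn {l : ℂ} (hl : l ∈ D) : ‖l‖ ≤ 1 := mem_closedBall_zero_iff.mp hl
  have hBle {l : ℂ} (hl : l ∈ D) (n : ℕ) : ‖complMul (B l) n‖ ≤ 1 :=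
    norm_complMul_le_one (fun p hp ↦ norm_blaschke_le_one (hz p hp) (hDn hl)) n
  have hBm (l : ℂ) : complMul (B l) m = 1 := complMul_eq_one fun p hp ↦ by
    simp only [hB, blaschke, if_pos (hzm p hp)]
  have hBd (n : ℕ) {l : ℂ} (hl : l ∈ D) : DifferentiableAt ℂ (fun l ↦ complMul (B l) n) l := by
    simp only [complMul]
    refine DifferentiableAt.fun_finsetProd fun p hp ↦ DifferentiableAt.pow ?_ _
    exact differentiableAt_blaschke (hz p (Nat.prime_of_mem_primeFactors hp)) (hDn hl)
  have hgB {l : ℂ} (hl : l ∈ D) (n : ℕ) : ‖g n * complMul (B l) n‖ ≤ C :=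
    norm_mul_complMul_le hg (fun p hp ↦ norm_blaschke_le_one (hz p hp) (hDn hl)) n
  have hC : 0 ≤ C := (norm_nonneg _).trans (hg 0)
  set σ₀ := s₀.re with hσ₀
  set S : ℝ → ℂ := fun σ ↦ σ + s₀.im * I with hS
  have hSre (σ : ℝ) : (S σ).re = σ := by simp [hS]
  have hS₀ : S σ₀ = s₀ := re_add_im s₀
  set Ψ : ℂ → ℝ → ℂ := fun l σ ↦ LSeries (fun n ↦ g n * complMul (B l) n) (S σ) with hΨ
  obtain ⟨σ₂, hσ₂₀, hσ₂, hne⟩ := exists_forall_LSeries_mul_ne_zero hg hm hgm hmin σ₀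
  have hΨ₂ {l : ℂ} (hl : l ∈ D) : Ψ l σ₂ ≠ 0 := hne _ _ (hBle hl) (hBm l) (hSre σ₂)
  have hsum : Summable fun n : ℕ ↦ C / (n : ℝ) ^ σ₀ := by
    simpa only [div_eq_mul_inv] using (Real.summable_nat_rpow_inv.mpr hs₀).mul_left C
  have hterm {l : ℂ} (hl : l ∈ D) {σ : ℝ} (hσ : σ₀ ≤ σ) (n : ℕ) :
      ‖LSeries.term (fun n ↦ g n * complMul (B l) n) (S σ) n‖ ≤ C / (n : ℝ) ^ σ₀ := by
    rw [LSeries.norm_term_eq, hSre]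
    split_ifs with hn
    · positivity
    · have hn1 : (1 : ℝ) ≤ n := by exact_mod_cast Nat.one_le_iff_ne_zero.mpr hn
      gcongr
      exact hgB hl n
  have hScont : Continuous S := by simp only [hS]; fun_prop
  have hcont : ContinuousOn (fun q : ℂ × ℝ ↦ Ψ q.1 q.2) (D ×ˢ Set.Icc σ₀ σ₂) := by
    refine continuousOn_tsum (fun n ↦ ?_) hsum fun n q hq ↦ hterm hq.1 hq.2.1 n
    rcases eq_or_ne n 0 with rfl | hn
    · simpa only [LSeries.term_zero] using continuousOn_const
    · have hn0 : (n : ℂ) ≠ 0 := by exact_mod_cast hn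
      simp only [LSeries.term_of_ne_zero hn]
      refine ContinuousOn.div (continuousOn_const.mul ?_) ?_ fun q _ ↦ ?_
      · have h1 : ContinuousOn (fun l ↦ complMul (B l) n) D :=
          fun l hl ↦ (hBd n hl).continuousAt.continuousWithinAt
        exact h1.comp continuousOn_fst fun q hq ↦ hq.1
      · exact ((hScont.comp continuous_snd).const_cpow (.inl hn0)).continuousOn
      · exact (cpow_ne_zero_iff.mpr (.inl hn0))
  have hdiff (σ : ℝ) (hσ : σ ∈ Set.Icc σ₀ σ₂) :
      DifferentiableOn ℂ (Ψ · σ) (Metric.ball 0 1) := by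
    refine differentiableOn_tsum_of_summable_norm hsum (fun n ↦ ?_) Metric.isOpen_ball
      fun n l hl ↦ hterm (Metric.ball_subset_closedBall hl) hσ.1 n
    rcases eq_or_ne n 0 with rfl | hn
    · simpa only [LSeries.term_zero] using differentiableOn_const _
    · simp only [LSeries.term_of_ne_zero hn]
      refine fun l hl ↦ DifferentiableAt.differentiableWithinAt ?_
      exact ((hBd n (Metric.ball_subset_closedBall hl)).const_mul _).div_const _
  have hB0 : B 0 = z := funext fun p ↦ blaschke_zero (z p)
  obtain ⟨l, hl, σ, hσ, hl0⟩ := exists_zero_norm_eq_one hσ₂₀.le hcont hdiff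
    ⟨0, Metric.mem_closedBall_self zero_le_one, by simp only [hΨ, hB0, hS₀, h₀]⟩ fun l ↦ hΨ₂
  exact ⟨B l, fun p hp ↦ norm_blaschke_eq_one (hz p hp) hl,
    ⟨S σ, by rw [hSre]; exact hs₀.trans_le hσ.1, hl0⟩,
    S σ₂, by rwa [hSre], hΨ₂ (mem_closedBall_zero_iff.mpr hl.le)⟩

theorem one_sub_mul_tsum_eq {φ : ℕ → ℂ} (hφ : Summable φ) {p : ℕ} (hp : p ≠ 0) {x : ℂ}
    (h : ∀ m, φ (p * m) = x * φ m) :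
    (1 - x) * ∑' m, φ m = ∑' m, if p ∣ m then 0 else φ m := by
  have h0 : ∑' m, (if p ∣ m then φ m else 0) = x * ∑' m, φ m := by
    rw [← tsum_mul_left, ← (mul_right_injective₀ hp).tsum_eq]
    · simp [h]
    · intro m hm
      rw [Function.mem_support] at hm
      obtain ⟨k, rfl⟩ : p ∣ m := by
        by_contra hpm
        exact hm (if_neg hpm)
      exact ⟨k, rfl⟩
  have h1 : Summable fun m ↦ if p ∣ m then φ m else 0 := by
    refine (hφ.indicator {m | p ∣ m}).congr fun m ↦ ?_
    by_cases hm : p ∣ m <;> simp [Set.indicator, hm]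
  rw [sub_mul, one_mul, ← h0, ← hφ.tsum_sub h1]
  refine tsum_congr fun m ↦ ?_
  split_ifs <;> simp

/-- Sieving out the multiples of finitely many primes from a series. -/
theorem prod_one_sub_mul_tsum_eq {φ : ℕ → ℂ} (hφ : Summable φ) {P : Finset ℕ}
    (hP : ∀ p ∈ P, p.Prime) {x : ℕ → ℂ} (h : ∀ p ∈ P, ∀ m, φ (p * m) = x p * φ m) :
    (∏ p ∈ P, (1 - x p)) * ∑' m, φ m = ∑' m, if ∃ p ∈ P, p ∣ m then 0 else φ m := by
  classical
  induction P using Finset.induction_on generalizing φ with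
  | empty => simp
  | insert p P hp ih =>
    have hpp := hP p (Finset.mem_insert_self p P)
    have hψ : Summable fun m ↦ if p ∣ m then 0 else φ m := by
      refine (hφ.indicator {m | ¬ p ∣ m}).congr fun m ↦ ?_
      by_cases hm : p ∣ m <;> simp [Set.indicator, hm]
    rw [Finset.prod_insert hp, mul_comm (1 - x p), mul_assoc,
      one_sub_mul_tsum_eq hφ hpp.ne_zero (h p (Finset.mem_insert_self p P)),
      ih hψ (fun r hr ↦ hP r (Finset.mem_insert_of_mem hr))]
    · refine tsum_congr fun m ↦ ?_
      simp only [Finset.exists_mem_insert]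
      by_cases h1 : p ∣ m <;> simp [h1]
    · intro r hr m
      have hrp := hP r (Finset.mem_insert_of_mem hr)
      have hne : p ≠ r := fun h ↦ hp (h ▸ hr)
      have : p ∣ r * m ↔ p ∣ m := by
        rw [hpp.dvd_mul, Nat.prime_dvd_prime_iff_eq hpp hrp]
        simp [hne]
      simp only [this, h r (Finset.mem_insert_of_mem hr)]
      split_ifs <;> simp

/-- The exponential of a small number is a product of Cayley transforms of prescribed sizes. -/
theorem exists_cayley_of_le {P : Finset ℕ} {w : ℕ → ℝ} (hw : ∀ p ∈ P, 0 < w p ∧ w p ≤ 1) {κ : ℂ}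
    (hκ : 4 * ‖κ‖ ≤ ∑ p ∈ P, w p) (hP : P.Nonempty) :
    ∃ x : ℕ → ℂ, (∀ p ∈ P, ‖x p‖ ≤ w p / 2) ∧
      ∏ p ∈ P, (1 + x p) = Complex.exp κ * ∏ p ∈ P, (1 - x p) := by
  set S := ∑ p ∈ P, w p with hS
  have hS0 : 0 < S := Finset.sum_pos (fun p hp ↦ (hw p hp).1) hP
  set θ : ℕ → ℂ := fun p ↦ κ * (w p / S : ℝ) with hθ
  set y : ℕ → ℂ := fun p ↦ Complex.exp (θ p) with hy
  have hθn (p) (hp : p ∈ P) : ‖θ p‖ ≤ w p / 4 := by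
    rw [hθ, norm_mul, Complex.norm_real, Real.norm_of_nonneg (div_pos (hw p hp).1 hS0).le,
      mul_div_assoc', div_le_iff₀ hS0]
    nlinarith [(hw p hp).1]
  have hy1 (p) (hp : p ∈ P) : ‖y p - 1‖ ≤ w p / 2 := by
    have := hθn p hp
    have := Complex.norm_exp_sub_one_le (x := θ p) (by linarith [hw p hp])
    linarith
  have hy2 (p) (hp : p ∈ P) : 1 ≤ ‖y p + 1‖ := by
    have h1 := hy1 p hp
    have h2 : ‖(2 : ℂ)‖ ≤ ‖y p + 1‖ + ‖y p - 1‖ := by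
      rw [show (2 : ℂ) = (y p + 1) - (y p - 1) by ring]
      exact norm_sub_le _ _
    rw [Complex.norm_ofNat] at h2
    linarith [hw p hp]
  refine ⟨fun p ↦ (y p - 1) / (y p + 1), fun p hp ↦ ?_, ?_⟩
  · rw [norm_div]
    exact (div_le_self (norm_nonneg _) (hy2 p hp)).trans (hy1 p hp)
  · have h1 : Complex.exp κ = ∏ p ∈ P, y p := by
      rw [← Complex.exp_sum, ← Finset.mul_sum, ← Complex.ofReal_sum, ← Finset.sum_div, ← hS,
        div_self hS0.ne', Complex.ofReal_one, mul_one]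
    rw [h1, ← Finset.prod_mul_distrib]
    refine Finset.prod_congr rfl fun p hp ↦ ?_
    have : y p + 1 ≠ 0 := norm_pos_iff.mp (zero_lt_one.trans_le (hy2 p hp))
    field_simp
    ring

open Complex in
theorem LSeriesSummable_indicator_factoredNumbers (S : Finset ℕ) {h : ℕ → ℂ} {C : ℝ}
    (hh : ∀ n, ‖h n‖ ≤ C) :
    LSeriesSummable ((Nat.factoredNumbers S).indicator h) (1 / 2 : ℝ) := by
  have h2 : ((1 / 2 : ℝ) : ℂ) ≠ 0 := by norm_num
  have h1 := (EulerProduct.summable_and_hasSum_factoredNumbers_prod_filter_prime_geometric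
    (f := (riemannZetaSummandHom h2 : ℕ →* ℂ)) (fun {p} hp ↦ ?_) S).1
  · have h3 : Summable ((Nat.factoredNumbers S).indicator fun n ↦ ‖riemannZetaSummandHom h2 n‖) :=
      summable_subtype_iff_indicator.mp h1
    refine Summable.of_norm_bounded (h3.mul_left C) fun n ↦ ?_
    rcases eq_or_ne n 0 with rfl | hn
    · simp [LSeries.term, Nat.factoredNumbers]
    · rw [LSeries.term_of_ne_zero hn]
      by_cases hnS : n ∈ Nat.factoredNumbers S
      · rw [Set.indicator_of_mem hnS, Set.indicator_of_mem hnS, norm_div]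
        simp only [riemannZetaSummandHom, MonoidWithZeroHom.coe_mk, ZeroHom.coe_mk]
        rw [cpow_neg, norm_inv, div_eq_mul_inv]
        exact mul_le_mul_of_nonneg_right (hh n) (by positivity)
      · rw [Set.indicator_of_notMem hnS, Set.indicator_of_notMem hnS]
        simp
  · simp only [riemannZetaSummandHom, MonoidHom.coe_coe, MonoidWithZeroHom.coe_mk, ZeroHom.coe_mk]
    rw [norm_natCast_cpow_of_pos hp.pos]
    exact Real.rpow_lt_one_of_one_lt_of_neg (by exact_mod_cast hp.one_lt) (by simp)

theorem LSeries_indicator_factoredNumbers_analyticAt (S : Finset ℕ) {h : ℕ → ℂ} {C : ℝ}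
    (hh : ∀ n, ‖h n‖ ≤ C) {s : ℂ} (hs : 1 / 2 < s.re) :
    AnalyticAt ℂ (LSeries ((Nat.factoredNumbers S).indicator h)) s := by
  refine LSeries_analyticOnNhd _ s ?_
  have := (LSeriesSummable_indicator_factoredNumbers S hh).abscissaOfAbsConv_le
  rw [Complex.ofReal_re] at this
  exact this.trans_lt (by exact_mod_cast hs)

theorem LSeries_indicator_factoredNumbers_eventually_ne_zero (S : Finset ℕ) {h : ℕ → ℂ} {C : ℝ}
    (hh : ∀ n, ‖h n‖ ≤ C) {m : ℕ} (hm : m ∈ Nat.factoredNumbers S) (hhm : h m ≠ 0) :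
    ∀ᶠ s in 𝓝[≠] 1, LSeries ((Nat.factoredNumbers S).indicator h) s ≠ 0 := by
  set D := LSeries ((Nat.factoredNumbers S).indicator h) with hD
  have han : AnalyticOnNhd ℂ D {s | 1 / 2 < s.re} := fun s hs ↦
    LSeries_indicator_factoredNumbers_analyticAt S hh hs
  have h1 : (1 : ℂ) ∈ {s : ℂ | 1 / 2 < s.re} := by simp; norm_num
  refine (han 1 h1).eventually_eq_zero_or_eventually_ne_zero.resolve_left fun h0 ↦ ?_
  have hzero := han.eqOn_zero_of_preconnected_of_eventuallyEq_zero
    (convex_halfSpace_re_gt _).isPreconnected h1 h0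
  have h2 : (fun x : ℝ ↦ D x) =ᶠ[atTop] 0 := by
    filter_upwards [eventually_gt_atTop (1 / 2)] with x hx
    exact hzero (show 1 / 2 < (x : ℂ).re by simpa using hx)
  rcases LSeries_eventually_eq_zero_iff'.mp h2 with h3 | h3
  · have := h3 m (Nat.ne_zero_of_mem_factoredNumbers hm)
    rw [Set.indicator_of_mem hm] at this
    exact hhm this
  · have := (LSeriesSummable_indicator_factoredNumbers S hh).abscissaOfAbsConv_le
    rw [h3] at this
    exact absurd this (by simp)

theorem exists_eventually_log_le {r : ℝ → ℂ} {c : ℝ} (hr : ContinuousAt r c) (h0 : r c ≠ 0) :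
    ∃ K : ℝ, ∀ᶠ σ in 𝓝 c, ∃ κ : ℂ, ‖κ‖ ≤ K ∧ Complex.exp κ = r σ := by
  have h1 : ContinuousAt (fun σ ↦ |Real.log ‖r σ‖|) c :=
    (hr.norm.log (norm_ne_zero_iff.mpr h0)).abs
  refine ⟨|Real.log ‖r c‖| + 1 + Real.pi, ?_⟩
  filter_upwards [h1.eventually_le_const (lt_add_one _), hr.eventually_ne h0] with σ hσ hσ0
  refine ⟨Complex.log (r σ), ?_, Complex.exp_log hσ0⟩
  refine (Complex.norm_le_abs_re_add_abs_im _).trans ?_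
  rw [Complex.log_re, Complex.log_im]
  exact add_le_add hσ (Complex.abs_arg_le_pi _)

theorem exists_finset_primes_residueClass_sum_gt {M : ℕ} [NeZero M] {a : ZMod M} (ha : IsUnit a)
    (K : ℝ) : ∃ P : Finset ℕ, (∀ p ∈ P, p.Prime ∧ (p : ZMod M) = a) ∧ K < ∑ p ∈ P, (p : ℝ)⁻¹ := by
  classical
  by_contra! hcon
  refine not_summable_inv_primes_residueClass ha (summable_of_sum_le (c := K) (fun n ↦ ?_)
    fun u ↦ ?_)
  · split_ifs <;> positivity
  · rw [← Finset.sum_filter]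
    exact hcon _ fun p hp ↦ (Finset.mem_filter.mp hp).2

theorem prod_one_sub_mul_LSeries_eq {S P : Finset ℕ}
    (hP : ∀ p ∈ P, p.Prime ∧ p ∉ S) {h : ℕ → ℂ} {ε : ℂ} (hh : ∀ p ∈ P, ∀ n, h (p * n) = ε * h n)
    {x : ℕ → ℂ} {s : ℂ} {z : ℕ → ℂ} (hzS : ∀ p ∈ S, z p = 1)
    (hzP : ∀ p ∈ P, z p = x p * (p : ℂ) ^ s)
    (hz0 : ∀ p, p.Prime → p ∉ S → p ∉ P → z p = 0)
    (hsum : LSeriesSummable (fun n ↦ h n * complMul z n) s) :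
    (∏ p ∈ P, (1 - ε * x p)) * LSeries (fun n ↦ h n * complMul z n) s =
      LSeries ((Nat.factoredNumbers S).indicator h) s := by
  rw [LSeries, LSeries, prod_one_sub_mul_tsum_eq hsum (fun p hp ↦ (hP p hp).1)]
  · refine tsum_congr fun n ↦ ?_
    rcases eq_or_ne n 0 with rfl | hn
    · simp [LSeries.term]
    rw [LSeries.term_of_ne_zero hn, LSeries.term_of_ne_zero hn]
    by_cases hnS : n ∈ Nat.factoredNumbers S
    · rw [if_neg, Set.indicator_of_mem hnS, complMul_eq_one, mul_one]
      · exact fun p hp ↦ hzS p (hnS.2 p (Nat.mem_primeFactors_iff_mem_primeFactorsList.mp hp))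
      · rintro ⟨p, hp, hpn⟩
        exact (hP p hp).2 (hnS.2 p ((Nat.mem_primeFactorsList hn).mpr ⟨(hP p hp).1, hpn⟩))
    · rw [Set.indicator_of_notMem hnS, zero_div, ite_eq_left_iff]
      intro hcon
      obtain ⟨p, hpn, hpS⟩ : ∃ p ∈ n.primeFactors, p ∉ S := by
        by_contra! hall
        exact hnS ⟨hn, fun p hp ↦ hall p (Nat.mem_primeFactors_iff_mem_primeFactorsList.mpr hp)⟩
      rw [complMul_eq_zero hpn, mul_zero, zero_div]
      exact hz0 p (Nat.prime_of_mem_primeFactors hpn) hpS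
        fun hpP ↦ hcon ⟨p, hpP, Nat.dvd_of_mem_primeFactors hpn⟩
  · intro p hp n
    have hpp := (hP p hp).1
    rcases eq_or_ne n 0 with rfl | hn
    · simp [LSeries.term]
    have hps : (p : ℂ) ^ s ≠ 0 := by
      simp [Complex.cpow_eq_zero_iff, hpp.ne_zero]
    have hns : (n : ℂ) ^ s ≠ 0 := by
      simp [Complex.cpow_eq_zero_iff, hn]
    rw [LSeries.term_of_ne_zero hn, LSeries.term_of_ne_zero (mul_ne_zero hpp.ne_zero hn),
      hh p hp, complMul_prime_mul z hpp hn, hzP p hp, Nat.cast_mul,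
      Complex.natCast_mul_natCast_cpow]
    field_simp

/-- Twisting a periodic sequence by a completely multiplicative function of modulus at most one
produces a zero of its L-series to the right of the line of absolute convergence. -/
theorem exists_complMul_zero_of_eq_neg {M : ℕ} [NeZero M] {g : ℕ → ℂ} {C : ℝ}
    (hg : ∀ n, ‖g n‖ ≤ C) (hper : ∀ m n, m ≡ n [MOD M] → g m = g n)
    {m : ℕ} (hmM : m ∣ M) (hgm : g m ≠ 0) (hgm' : g ((M - 1) * m) = 0) :
    ∃ (s : ℂ) (z : ℕ → ℂ), 1 < s.re ∧ (∀ p, p.Prime → z p = 1 ∨ ‖z p‖ ≤ 1 / 2) ∧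
      (∀ p ∈ M.primeFactors, z p = 1) ∧ LSeries (fun n ↦ g n * complMul z n) s = 0 := by
  classical
  have hM : M ≠ 0 := NeZero.ne M
  set S := M.primeFactors with hS
  have hmS : m ∈ Nat.factoredNumbers S :=
    ⟨ne_zero_of_dvd_ne_zero hM hmM, fun p hp ↦
      Nat.primeFactors_mono hmM hM (Nat.mem_primeFactors_iff_mem_primeFactorsList.mpr hp)⟩
  set u : ℕ → ℂ := fun n ↦ g n + g ((M - 1) * n) with hu
  set v : ℕ → ℂ := fun n ↦ g n - g ((M - 1) * n) with hv
  have hun (n) : ‖u n‖ ≤ C + C := (norm_add_le _ _).trans (add_le_add (hg _) (hg _))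
  have hvn (n) : ‖v n‖ ≤ C + C := (norm_sub_le _ _).trans (add_le_add (hg _) (hg _))
  set A := LSeries ((Nat.factoredNumbers S).indicator u) with hA
  set B := LSeries ((Nat.factoredNumbers S).indicator v) with hB
  have hneg (p : ℕ) (hp : (p : ZMod M) = -1) (n : ℕ) :
      g (p * n) = g ((M - 1) * n) ∧ g ((M - 1) * (p * n)) = g n := by
    have h1 : ((M - 1 : ℕ) : ZMod M) = -1 := by
      rw [Nat.cast_sub (Nat.one_le_iff_ne_zero.mpr hM)]
      simp
    constructor <;> refine hper _ _ ((ZMod.natCast_eq_natCast_iff _ _ _).mp ?_) <;>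
      push_cast <;> simp [hp, h1]
  -- a vertical line on which both series are nonzero
  obtain ⟨t, hAt, hBt⟩ : ∃ t : ℝ, A (1 + t * Complex.I) ≠ 0 ∧ B (1 + t * Complex.I) ≠ 0 := by
    have hcont : Tendsto (fun t : ℝ ↦ (1 + t * Complex.I : ℂ)) (𝓝[≠] 0) (𝓝[≠] 1) := by
      refine tendsto_nhdsWithin_iff.mpr ⟨?_, ?_⟩
      · refine Tendsto.mono_left ?_ nhdsWithin_le_nhds
        exact Continuous.tendsto' (by fun_prop) _ _ (by simp)
      · filter_upwards [self_mem_nhdsWithin] with t ht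
        simpa using ht
    have h1 := LSeries_indicator_factoredNumbers_eventually_ne_zero S hun hmS
      (by simpa [hu, hgm'] using hgm)
    have h2 := LSeries_indicator_factoredNumbers_eventually_ne_zero S hvn hmS
      (by simpa [hv, hgm'] using hgm)
    exact (hcont.eventually (h1.and h2)).exists
  set l : ℝ → ℂ := fun σ ↦ σ + t * Complex.I with hl
  have hlre (σ : ℝ) : (l σ).re = σ := by simp [hl]
  have hl1 : ContinuousAt l 1 := by fun_prop
  have hl1' : l 1 = 1 + t * Complex.I := by simp [hl]
  have hcA : ContinuousAt (fun σ ↦ A (l σ)) 1 :=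
    ContinuousAt.comp (LSeries_indicator_factoredNumbers_analyticAt S hun
      (by rw [hlre]; norm_num)).continuousAt hl1
  have hcB : ContinuousAt (fun σ ↦ B (l σ)) 1 :=
    ContinuousAt.comp (LSeries_indicator_factoredNumbers_analyticAt S hvn
      (by rw [hlre]; norm_num)).continuousAt hl1
  rw [← hl1'] at hAt hBt
  obtain ⟨K, hK⟩ := exists_eventually_log_le (hcB.neg.div hcA hAt)
    (div_ne_zero (neg_ne_zero.mpr hBt) hAt)
  obtain ⟨P, hP, hPK⟩ := exists_finset_primes_residueClass_sum_gt
    (a := (-1 : ZMod M)) isUnit_one.neg (max (4 * K) 0)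
  have hPσ : ∀ᶠ σ in 𝓝 (1 : ℝ), max (4 * K) 0 < ∑ p ∈ P, (p : ℝ) ^ (-σ) := by
    have : ContinuousAt (fun σ : ℝ ↦ ∑ p ∈ P, (p : ℝ) ^ (-σ)) 1 := by
      refine tendsto_finsetSum _ fun p hp ↦ ?_
      exact ContinuousAt.rpow continuousAt_const continuousAt_neg
        (Or.inl (by exact_mod_cast (hP p hp).1.ne_zero))
    refine this.eventually_const_lt ?_
    simpa [Real.rpow_neg_one] using hPK
  obtain ⟨σ, ⟨⟨κ, hκK, hκ⟩, hPσ, hAσ⟩, hσ⟩ :=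
    ((eventually_nhdsWithin_of_eventually_nhds (hK.and (hPσ.and (hcA.eventually_ne hAt)))).and
      (self_mem_nhdsWithin (a := (1 : ℝ)) (s := Set.Ioi 1))).exists
  have hσ1 : 1 < σ := hσ
  obtain ⟨x, hx, hxprod⟩ := exists_cayley_of_le (P := P) (w := fun p ↦ (p : ℝ) ^ (-σ)) (κ := κ)
    (fun p hp ↦ ⟨Real.rpow_pos_of_pos (by exact_mod_cast (hP p hp).1.pos) _,
      Real.rpow_le_one_of_one_le_of_nonpos (by exact_mod_cast (hP p hp).1.one_le) (by linarith)⟩)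
    ((mul_le_mul_of_nonneg_left hκK zero_le_four).trans ((le_max_left _ _).trans hPσ.le))
    (Finset.nonempty_iff_ne_empty.mpr fun h ↦ by
      rw [h, Finset.sum_empty] at hPσ
      exact absurd hPσ (not_lt.mpr (le_max_right _ _)))
  have hPS (p) (hp : p ∈ P) : p.Prime ∧ p ∉ S := by
    refine ⟨(hP p hp).1, fun hpS ↦ ?_⟩
    have h1 : p.Coprime M := (ZMod.isUnit_iff_coprime p M).mp ((hP p hp).2 ▸ isUnit_one.neg)
    exact ((hP p hp).1.coprime_iff_not_dvd.mp h1) (Nat.dvd_of_mem_primeFactors hpS)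
  set z : ℕ → ℂ := fun p ↦ if p ∈ S then 1 else if p ∈ P then x p * (p : ℂ) ^ l σ else 0 with hz
  have hzS (p) (hp : p ∈ S) : z p = 1 := by simp [hz, hp]
  have hzP (p) (hp : p ∈ P) : z p = x p * (p : ℂ) ^ l σ := by simp [hz, hp, (hPS p hp).2]
  have hz0 (p) (_ : p.Prime) (hpS : p ∉ S) (hpP : p ∉ P) : z p = 0 := by simp [hz, hpS, hpP]
  have hzle (p) (hp : p.Prime) : z p = 1 ∨ ‖z p‖ ≤ 1 / 2 := by
    by_cases hpS : p ∈ S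
    · exact Or.inl (hzS p hpS)
    by_cases hpP : p ∈ P
    · refine Or.inr ?_
      rw [hzP p hpP, norm_mul, Complex.norm_natCast_cpow_of_pos hp.pos, hlre]
      refine (mul_le_mul_of_nonneg_right (hx p hpP) (by positivity)).trans_eq ?_
      have h0 : (0 : ℝ) < p := by exact_mod_cast hp.pos
      rw [Real.rpow_neg h0.le]
      have := (Real.rpow_pos_of_pos h0 σ).ne'
      field_simp
    · exact Or.inr (by simp [hz0 p hp hpS hpP])
  have hz1 (p) (hp : p.Prime) : ‖z p‖ ≤ 1 := by
    rcases hzle p hp with h | h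
    · simp [h]
    · linarith
  have hlσ : 1 < (l σ).re := by rwa [hlre]
  have hsu := LSeriesSummable_of_norm_le (norm_mul_complMul_le hun hz1) hlσ
  have hsv := LSeriesSummable_of_norm_le (norm_mul_complMul_le hvn hz1) hlσ
  have hu' (p) (hp : p ∈ P) (n : ℕ) : u (p * n) = 1 * u n := by
    obtain ⟨h1, h2⟩ := hneg p (hP p hp).2 n
    simp only [hu, h1, h2]
    ring
  have hv' (p) (hp : p ∈ P) (n : ℕ) : v (p * n) = -1 * v n := by
    obtain ⟨h1, h2⟩ := hneg p (hP p hp).2 n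
    simp only [hv, h1, h2]
    ring
  have hAeq := prod_one_sub_mul_LSeries_eq hPS hu' hzS hzP hz0 hsu
  have hBeq := prod_one_sub_mul_LSeries_eq hPS hv' hzS hzP hz0 hsv
  refine ⟨l σ, z, hlσ, hzle, hzS, ?_⟩
  simp only [one_mul, neg_mul, sub_neg_eq_add] at hAeq hBeq
  set U := LSeries (fun n ↦ u n * complMul z n) (l σ) with hU
  set V := LSeries (fun n ↦ v n * complMul z n) (l σ) with hV
  have hsum : 2 * LSeries (fun n ↦ g n * complMul z n) (l σ) = U + V := by
    rw [hU, hV, ← LSeries_add hsu hsv, ← LSeries_smul]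
    congr 1
    funext n
    simp only [Pi.add_apply, Pi.smul_apply, hu, hv, smul_eq_mul]
    ring
  have hUV : (∏ p ∈ P, (1 - x p)) * A (l σ) * Complex.exp κ * (U + V) = 0 := by
    have hκ' : Complex.exp κ * A (l σ) = -B (l σ) := by
      rw [hκ]
      simp only [Pi.div_apply, Pi.neg_apply]
      exact div_mul_cancel₀ _ hAσ
    rw [hxprod] at hBeq
    linear_combination (A (l σ) * Complex.exp κ) * hAeq + A (l σ) * hBeq + A (l σ) * hκ'
  have hprod : ∏ p ∈ P, (1 - x p) ≠ 0 := fun h ↦ hAσ (by rw [hA, ← hAeq, h, zero_mul])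
  have : U + V = 0 := by
    simpa [hprod, hAσ, Complex.exp_ne_zero] using hUV
  simpa [← hsum] using this

/-- The sequence supported on the residue class of `a` modulo `b`, with value `f n` at
`b * n + a`. -/
def extendResidueClass (f : ℕ → ℂ) (a b m : ℕ) : ℂ :=
  if m % b = a then f (m / b) else 0

theorem extendResidueClass_mul_add (f : ℕ → ℂ) {a b : ℕ} (hb : a < b) (n : ℕ) :
    extendResidueClass f a b (b * n + a) = f n := by
  rw [extendResidueClass, if_pos (by rw [Nat.mul_add_mod, Nat.mod_eq_of_lt hb]), Nat.mul_add_div (by lia),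
    Nat.div_eq_of_lt hb, add_zero]

theorem norm_extendResidueClass_le {f : ℕ → ℂ} {q : ℕ} (hq : 1 ≤ q)
    (hper : Function.Periodic f q) (a b m : ℕ) :
    ‖extendResidueClass f a b m‖ ≤ ∑ i ∈ Finset.range q, ‖f i‖ := by
  rw [extendResidueClass]
  split_ifs
  · rw [← hper.map_mod_nat]
    exact Finset.single_le_sum (f := fun i ↦ ‖f i‖) (fun _ _ ↦ norm_nonneg _)
      (Finset.mem_range.mpr (Nat.mod_lt _ hq))
  · rw [norm_zero]
    positivity

theorem extendResidueClass_eq_of_modEq {f : ℕ → ℂ} {q : ℕ} (hper : Function.Periodic f q)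
    (a : ℕ) {b m n : ℕ} (h : m ≡ n [MOD b * q]) :
    extendResidueClass f a b m = extendResidueClass f a b n := by
  have h1 : m % b = n % b := h.of_mul_right q
  have h2 : m / b % q = n / b % q := by
    rw [← Nat.mod_mul_right_div_self, ← Nat.mod_mul_right_div_self, h]
  rw [extendResidueClass, extendResidueClass, h1, ← hper.map_mod_nat (m / b), h2,
    hper.map_mod_nat]

theorem LSeries_extendResidueClass (f : ℕ → ℂ) {a b : ℕ} (ha : 1 ≤ a) (hb : a < b) (s : ℂ) :
    LSeries (extendResidueClass f a b) s =
      (b : ℂ) ^ (-s) * ∑' n : ℕ, f n / ((n : ℂ) + (a : ℂ) / (b : ℂ)) ^ s := by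
  have hb0 : (0 : ℝ) < b := by exact_mod_cast ha.trans hb.le
  have hinj : Function.Injective fun n ↦ b * n + a := fun m n h ↦ by
    simpa [show b ≠ 0 by lia] using h
  rw [LSeries, ← hinj.tsum_eq, ← tsum_mul_left]
  · refine tsum_congr fun n ↦ ?_
    have h1 : ((b * n + a : ℕ) : ℂ) = ((b : ℝ) : ℂ) * (((n : ℝ) + a / b : ℝ) : ℂ) := by
      push_cast
      have : (b : ℂ) ≠ 0 := by exact_mod_cast hb0.ne'
      field_simp
    rw [LSeries.term_of_ne_zero (by lia), extendResidueClass_mul_add f hb, h1,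
      Complex.mul_cpow_ofReal_nonneg hb0.le (by positivity), Complex.cpow_neg]
    push_cast
    rw [div_mul_eq_div_div, div_eq_mul_inv (f n)]
    ring
  · intro m hm
    refine ⟨m / b, ?_⟩
    have h1 : m % b = a := by
      by_contra h
      refine hm ?_
      rcases eq_or_ne m 0 with rfl | hm0
      · simp
      · rw [LSeries.term_of_ne_zero hm0, extendResidueClass, if_neg h, zero_div]
    have := Nat.div_add_mod m b
    rwa [h1] at this

theorem not_dvd_two_mul_of_ne_half {a b : ℕ} (hab : Nat.Coprime a b) (ha : 1 ≤ a) (hb : a < b)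
    (hhalf : (a : ℚ) / b ≠ 1 / 2) : ¬ b ∣ 2 * a := by
  intro h
  have h1 : b ≤ 2 := Nat.le_of_dvd two_pos (hab.symm.dvd_of_dvd_mul_right h)
  obtain rfl : b = 2 := by lia
  obtain rfl : a = 1 := by lia
  exact hhalf (by norm_num)

theorem exists_LSeries_extendResidueClass_zero {f : ℕ → ℂ} (hf : f ≠ 0) {q : ℕ} (hq : 1 ≤ q)
    (hper : Function.Periodic f q) {a b : ℕ} (ha : 1 ≤ a) (hb : a < b) (hdvd : ¬ b ∣ 2 * a)
    (T : ℝ) : ∃ s : ℂ, T < s.im ∧ 1 < s.re ∧ LSeries (extendResidueClass f a b) s = 0 := by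
  classical
  set g := extendResidueClass f a b with hgdef
  have hf' : ∃ n, f n ≠ 0 := Function.ne_iff.mp hf
  set k := Nat.find hf' with hk
  set m := b * k + a with hm
  have hgm : g m ≠ 0 := by
    rw [hgdef, extendResidueClass_mul_add f hb]
    exact Nat.find_spec hf'
  have hm0 : m ≠ 0 := by lia
  have hmin (n) (hn : n < m) : g n = 0 := by
    by_contra h
    rw [hgdef, extendResidueClass, ← ne_eq, ite_ne_right_iff] at h
    have h1 := Nat.find_min' hf' h.2
    have h2 := Nat.div_add_mod n b
    have h3 := Nat.mul_le_mul_left b h1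
    lia
  set M := b * q * m with hM
  have : NeZero M := ⟨mul_ne_zero (mul_ne_zero (by lia) (by lia)) hm0⟩
  have hgm' : g ((M - 1) * m) = 0 := by
    rw [hgdef, extendResidueClass, if_neg]
    intro h
    refine hdvd ?_
    have h1 : (M - 1) * m + m = M * m := by
      rw [← Nat.succ_mul, Nat.succ_eq_add_one, Nat.sub_add_cancel (NeZero.one_le)]
    have h2 : b ∣ (M - 1) * m + m := by
      rw [h1, hM, mul_assoc, mul_assoc]
      exact dvd_mul_right _ _
    have h3 : m % b = a := by rw [hm, Nat.mul_add_mod, Nat.mod_eq_of_lt hb]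
    rwa [Nat.dvd_iff_mod_eq_zero, Nat.add_mod, h, h3, ← two_mul, ← Nat.dvd_iff_mod_eq_zero] at h2
  have hg := norm_extendResidueClass_le hq hper a b
  obtain ⟨s, z, hs, hz, hzM, hzero⟩ := exists_complMul_zero_of_eq_neg hg
    (fun m n h ↦ extendResidueClass_eq_of_modEq hper a (h.of_mul_right _))
    (dvd_mul_left m _ : m ∣ M) hgm hgm'
  obtain ⟨w, hw, ⟨s₁, hs₁, h₁⟩, s₂, hs₂, h₂⟩ := exists_unimodular_complMul_zero hg hm0 hgm hmin hz
    (fun p hp ↦ hzM p (Nat.primeFactors_mono (dvd_mul_left m _) (NeZero.ne M) hp)) hs hzero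
  exact exists_zero_im_gt_of_complMul_zero hg hw hs₁ h₁ hs₂ h₂ T

end

/-- For `f` periodic of period `q ≥ 1`, not identically zero, and
`α = a/b` rational with `gcd(a,b) = 1`, `1 ≤ a < b` and `a/b ≠ 1/2`, the series
`F(s, f, a/b) = ∑ f(n)/(n+a/b)^s` has infinitely many zeros with `Re s > 1`. -/
theorem generalized_hurwitz_zeros_rational
    (f : ℕ → ℂ) (hf : f ≠ 0) (q : ℕ) (hq : 1 ≤ q) (hper : ∀ n, f (n + q) = f n)
    (a b : ℕ) (hab : Nat.Coprime a b) (ha : 1 ≤ a) (hb : a < b)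
    (hhalf : (a : ℚ) / b ≠ 1 / 2) :
    {s : ℂ | 1 < s.re ∧
      ∑' n : ℕ, f n / ((n : ℂ) + (a : ℂ) / (b : ℂ)) ^ s = 0}.Infinite := by
  refine fun hfin ↦ ?_
  obtain ⟨T, hT⟩ := (hfin.image Complex.im).bddAbove
  obtain ⟨s, hsT, hs, h0⟩ := exists_LSeries_extendResidueClass_zero hf hq hper ha hb
    (not_dvd_two_mul_of_ne_half hab ha hb hhalf) T
  refine hsT.not_ge (hT ⟨s, ⟨hs, ?_⟩, rfl⟩)
  rw [LSeries_extendResidueClass f ha hb] at h0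
  refine (mul_eq_zero.mp h0).resolve_left ?_
  simp [Complex.cpow_eq_zero_iff, show b ≠ 0 by lia]
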